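/- Let 1 ≤ p ≤ n−1 and let u = Σ'_{|J|=p} u_J dz_J be a (p,0)-form with coefficients in A²(ℂⁿ, e^{-|z|²}) such that u ∈ dom(∂) ∩ dom(∂*). Then ‖u‖² ≤ (1/p)(‖∂u‖² + ‖∂*u‖²). -/

import Mathlib

open MeasureTheory Filter Complex Finset

noncomputable section

/-- Points of `ℂⁿ`. -/
abbrev Cn (n : ℕ) := Fin n → ℂ

/-- A form with coefficients indexed by subsets of `{1,…,n}`; a `(p,0)`-form
`Σ'_{|J|=p} u_J dz_J` is such a family supported on sets of cardinality `p`. -/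
abbrev FormC (n : ℕ) := Finset (Fin n) → Cn n → ℂ

/-- The Fock weight `e^{-|z|²}` on `ℂⁿ`. -/
def fWt {n : ℕ} (z : Cn n) : ℝ := Real.exp (-(∑ j, ‖z j‖ ^ 2))

/-- Squared Fock norm `‖f‖² = ∫ |f|² e^{-|z|²} dλ`. -/
def fNormSq {n : ℕ} (f : Cn n → ℂ) : ℝ := ∫ z : Cn n, ‖f z‖ ^ 2 * fWt z

/-- Fock inner product `(f,g) = ∫ f ḡ e^{-|z|²} dλ`. -/
def fInner {n : ℕ} (f g : Cn n → ℂ) : ℂ :=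
  ∫ z : Cn n, f z * (starRingEnd ℂ) (g z) * fWt z

/-- Membership in the Fock space `A²(ℂⁿ, e^{-|z|²})`. -/
def MemF {n : ℕ} (f : Cn n → ℂ) : Prop :=
  Differentiable ℂ f ∧ Integrable (fun z : Cn n => ‖f z‖ ^ 2 * fWt z)

/-- The holomorphic partial derivative `∂f/∂z_j`. -/
def pdz {n : ℕ} (j : Fin n) (f : Cn n → ℂ) : Cn n → ℂ :=
  fun z => fderiv ℂ f z (Pi.single j 1)

/-- The sign `(-1)^{#{i ∈ J : i < j}}` arising from `dz_j ∧ dz_J`. -/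
def sgn {n : ℕ} (j : Fin n) (J : Finset (Fin n)) : ℂ :=
  (-1 : ℂ) ^ (J.filter (fun i => i < j)).card

/-- The operator `∂`: `(∂u)_L = Σ_{j ∈ L} ± ∂u_{L\{j}}/∂z_j`, i.e.
`∂u = Σ'_J Σ_j (∂u_J/∂z_j) dz_j ∧ dz_J`. -/
def dOp {n : ℕ} (u : FormC n) : FormC n :=
  fun L z => ∑ j ∈ L, sgn j (L.erase j) * pdz j (u (L.erase j)) z

/-- The adjoint `∂*`: `(∂*u)_K = Σ_{j ∉ K} ± z_j u_{K ∪ {j}}`, i.e.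
`∂*u = Σ'_K Σ_j z_j u_{jK} dz_K` on the Fock space. -/
def dStarOp {n : ℕ} (u : FormC n) : FormC n :=
  fun K z => ∑ j ∈ Kᶜ, sgn j K * (z j * u (insert j K) z)

/-- The complex Laplacian `□̃ = ∂*∂ + ∂∂*`. -/
def boxOp {n : ℕ} (u : FormC n) : FormC n :=
  fun J z => dStarOp (dOp u) J z + dOp (dStarOp u) J z

/-- All coefficients belong to the Fock space. -/
def MemA2 {n : ℕ} (u : FormC n) : Prop := ∀ J, MemF (u J)

/-- `u` is a `(p,0)`-form: only coefficients with `|J| = p` may be nonzero. -/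
def IsDeg {n : ℕ} (p : ℕ) (u : FormC n) : Prop :=
  ∀ J : Finset (Fin n), J.card ≠ p → u J = 0

/-- Squared norm of a form: `Σ'_J ‖u_J‖²`. -/
def formNormSq {n : ℕ} (u : FormC n) : ℝ := ∑ J : Finset (Fin n), fNormSq (u J)

/-- Inner product of forms: `Σ'_J (u_J, v_J)`. -/
def formInner {n : ℕ} (u v : FormC n) : ℂ := ∑ J : Finset (Fin n), fInner (u J) (v J)

/-- `u ∈ dom ∂`. -/
def domD {n : ℕ} (u : FormC n) : Prop := MemA2 u ∧ MemA2 (dOp u)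

/-- `u ∈ dom ∂*`. -/
def domDs {n : ℕ} (u : FormC n) : Prop := MemA2 u ∧ MemA2 (dStarOp u)

/-- `u ∈ dom □̃`: `u ∈ dom ∂ ∩ dom ∂*`, `∂u ∈ dom ∂*` and `∂*u ∈ dom ∂`. -/
def domBox {n : ℕ} (u : FormC n) : Prop :=
  domD u ∧ domDs u ∧ domDs (dOp u) ∧ domD (dStarOp u)

open scoped Real Topology

/-- The uniform probability measure on the angle interval `(0, 2π]`. -/
def circleProb : Measure ℝ := ProbabilityTheory.cond volume (Set.Ioc 0 (2 * π))

instance : IsProbabilityMeasure circleProb :=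
  ProbabilityTheory.cond_isProbabilityMeasure_of_finite
    (by simp [Real.pi_pos]) measure_Ioc_lt_top.ne

theorem integrable_circleProb {E : Type*} [NormedAddCommGroup E] {g : ℝ → E}
    (hg : Continuous g) : Integrable g circleProb := by
  refine Integrable.smul_measure ?_ (ENNReal.inv_ne_top.2 (by simp [Real.pi_pos]))
  exact (hg.integrableOn_Icc (a := 0) (b := 2 * π)).mono_set Set.Ioc_subset_Icc_self

/-- Cauchy's formula for the derivative of an entire function at the origin. -/
theorem deriv_zero_eq_integral_circleProb {F : ℂ → ℂ} (hF : Differentiable ℂ F) :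
    deriv F 0 = ∫ θ, exp (-(θ * I)) * F (exp (θ * I)) ∂circleProb := by
  have h := hF.diffContOnCl.circleIntegral_one_div_sub_center_pow_smul
    (c := 0) (R := 1) one_pos 1
  have h' : (2 * π * I) * deriv F 0 =
      I * ∫ θ in (0 : ℝ)..2 * π, exp (-(θ * I)) * F (exp (θ * I)) := by
    rw [← intervalIntegral.integral_const_mul]
    simp only [iteratedDeriv_one, Nat.factorial_one, Nat.cast_one, div_one, smul_eq_mul] at h
    rw [← h, circleIntegral]
    congr 1
    ext θ
    simp only [deriv_circleMap, circleMap, sub_zero, zero_add, ofReal_one, one_mul, smul_eq_mul,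
      exp_neg]
    have := exp_ne_zero (θ * I)
    field_simp
  rw [circleProb, ProbabilityTheory.cond, integral_smul_measure,
    ← intervalIntegral.integral_of_le Real.two_pi_pos.le]
  have hpi : (π : ℂ) ≠ 0 := by exact_mod_cast Real.pi_ne_zero
  have h2 : (2 * π) * deriv F 0 = ∫ θ in (0 : ℝ)..2 * π, exp (-(θ * I)) * F (exp (θ * I)) := by
    apply mul_left_cancel₀ I_ne_zero
    rw [← h']; ring
  rw [← h2]
  simp [Real.pi_pos.le]
  field_simp

variable {n : ℕ}

/-- Translation of `z` in the `j`-th coordinate by the unit complex number of angle `θ`. -/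
def rotShift (j : Fin n) (θ : ℝ) : Cn n := Pi.single j (exp (θ * I))

theorem rotShift_eq_smul (j : Fin n) (θ : ℝ) :
    rotShift j θ = exp (θ * I) • (Pi.single j 1 : Cn n) := by
  ext i; by_cases h : i = j <;> simp [rotShift, h]

@[fun_prop]
theorem continuous_rotShift (j : Fin n) : Continuous (rotShift j) := by
  have : rotShift j = fun θ : ℝ => exp (θ * I) • (Pi.single j 1 : Cn n) :=
    funext (rotShift_eq_smul j)
  rw [this]; fun_prop

theorem norm_rotShift_le (j : Fin n) (θ : ℝ) : ‖rotShift j θ‖ ≤ 1 := by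
  rw [rotShift_eq_smul, norm_smul, norm_exp_ofReal_mul_I, one_mul,
    Pi.norm_single, norm_one]

theorem pdz_eq_integral {f : Cn n → ℂ} (hf : Differentiable ℂ f) (j : Fin n) (z : Cn n) :
    pdz j f z = ∫ θ, exp (-(θ * I)) * f (z + rotShift j θ) ∂circleProb := by
  have h1 : HasDerivAt (fun ζ : ℂ => z + ζ • (Pi.single j 1 : Cn n)) (Pi.single j 1) 0 := by
    simpa using ((hasDerivAt_id (0 : ℂ)).smul_const (Pi.single j 1 : Cn n)).const_add z
  have h2 : HasDerivAt (fun ζ : ℂ => f (z + ζ • (Pi.single j 1 : Cn n))) (pdz j f z) 0 := by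
    have h3 : HasFDerivAt f (fderiv ℂ f z) (z + (0 : ℂ) • (Pi.single j 1 : Cn n)) := by
      simpa using (hf z).hasFDerivAt
    exact h3.comp_hasDerivAt 0 h1
  rw [← h2.deriv, deriv_zero_eq_integral_circleProb (by fun_prop)]
  simp only [rotShift_eq_smul]

theorem norm_fderiv_le_of_norm_le {f : Cn n → ℂ} (hf : Differentiable ℂ f) {z : Cn n} {C : ℝ}
    (hC : ∀ w ∈ Metric.ball z 1, ‖f w‖ ≤ C) : ‖fderiv ℂ f z‖ ≤ 2 * C := by
  have h := Complex.norm_fderiv_le_div_of_mapsTo_ball (c := z) (R₁ := 1) (R₂ := 2 * C)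
    hf.differentiableOn (fun w hw => ?_) one_pos
  · simpa using h
  · rw [mem_closedBall_iff_norm]
    linarith [norm_sub_le (f w) (f z), hC w hw, hC z (Metric.mem_ball_self one_pos)]

theorem differentiable_pdz {f : Cn n → ℂ} (hf : Differentiable ℂ f) (j : Fin n) :
    Differentiable ℂ (pdz j f) := by
  intro z₀
  obtain ⟨C, hC⟩ := (isCompact_closedBall z₀ 3).exists_bound_of_continuousOn
    hf.continuous.continuousOn
  have h := hasFDerivAt_integral_of_dominated_of_fderiv_le (μ := circleProb) (𝕜 := ℂ)
    (F := fun (z : Cn n) θ => exp (-(θ * I)) * f (z + rotShift j θ))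
    (F' := fun z θ => exp (-(θ * I)) • fderiv ℂ f (z + rotShift j θ))
    (x₀ := z₀) (s := Metric.ball z₀ 1) (bound := fun _ => 2 * C)
    (Metric.ball_mem_nhds _ one_pos) ?_ ?_ ?_ ?_ (integrable_const _) ?_
  · have e : pdz j f = fun z => ∫ θ, exp (-(θ * I)) * f (z + rotShift j θ) ∂circleProb :=
      funext fun z => pdz_eq_integral hf j z
    rw [e]
    exact h.differentiableAt
  · have := hf.continuous
    exact .of_forall fun z => Continuous.aestronglyMeasurable (by fun_prop)
  · have := hf.continuous
    exact integrable_circleProb (by fun_prop)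
  · apply AEStronglyMeasurable.fun_smul
    · exact Continuous.aestronglyMeasurable (by fun_prop)
    · apply Measurable.aestronglyMeasurable
      exact (measurable_fderiv ℂ f).comp
        (g := fun y => fderiv ℂ f y) (f := fun θ => z₀ + rotShift j θ)
        (by fun_prop : Continuous fun θ => z₀ + rotShift j θ).measurable
  · refine .of_forall fun θ z hz => ?_
    rw [norm_smul, ← neg_mul, ← ofReal_neg, norm_exp_ofReal_mul_I, one_mul]
    refine norm_fderiv_le_of_norm_le hf fun w hw => hC w ?_
    rw [mem_ball_iff_norm] at hz hw
    rw [mem_closedBall_iff_norm]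
    have e : w - z₀ = (w - (z + rotShift j θ)) + (z - z₀) + rotShift j θ := by abel
    rw [e]
    linarith [norm_add₃_le (a := w - (z + rotShift j θ)) (b := z - z₀) (c := rotShift j θ),
      norm_rotShift_le j θ]
  · refine .of_forall fun θ z _ => ?_
    exact ((hasFDerivAt_comp_add_right _).2 (hf _).hasFDerivAt).const_mul _

theorem norm_sq_pdz_le {f : Cn n → ℂ} (hf : Differentiable ℂ f) (j : Fin n) (z : Cn n) :
    ‖pdz j f z‖ ^ 2 ≤ ∫ θ, ‖f (z + rotShift j θ)‖ ^ 2 ∂circleProb := by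
  have hc := hf.continuous
  rw [pdz_eq_integral hf]
  have hconv : ConvexOn ℝ Set.univ (fun x : ℂ => ‖x‖ ^ 2) :=
    (convexOn_norm convex_univ).pow (fun _ _ => norm_nonneg _) 2
  refine (hconv.map_integral_le (by fun_prop) isClosed_univ (by simp)
    (integrable_circleProb (by fun_prop))
    (integrable_circleProb (by fun_prop))).trans_eq ?_
  congr 1
  ext θ
  rw [norm_mul, ← neg_mul, ← ofReal_neg, norm_exp_ofReal_mul_I, one_mul]

/-- The Gaussian weight `e^{-s|z|²}`. -/
def gWt (s : ℝ) (z : Cn n) : ℝ := Real.exp (-(s * ∑ j, ‖z j‖ ^ 2))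

theorem gWt_pos (s : ℝ) (z : Cn n) : 0 < gWt s z := Real.exp_pos _

theorem gWt_one (z : Cn n) : gWt 1 z = fWt z := by simp [gWt, fWt]

theorem gWt_anti {s t : ℝ} (h : s ≤ t) (z : Cn n) : gWt t z ≤ gWt s z := by
  unfold gWt
  gcongr

@[fun_prop]
theorem continuous_gWt (s : ℝ) : Continuous (gWt s : Cn n → ℝ) := by
  unfold gWt; fun_prop

theorem sq_mul_gWt_le {s t : ℝ} (h : s < t) (j : Fin n) (z : Cn n) :
    ‖z j‖ ^ 2 * gWt t z ≤ (t - s)⁻¹ * gWt s z := by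
  have hd : 0 < t - s := sub_pos.2 h
  set x := ∑ j, ‖z j‖ ^ 2 with hx
  have hj : ‖z j‖ ^ 2 ≤ x :=
    Finset.single_le_sum (f := fun j => ‖z j‖ ^ 2) (fun _ _ => sq_nonneg _) (Finset.mem_univ j)
  have he : gWt s z = Real.exp ((t - s) * x) * gWt t z := by
    rw [gWt, gWt, ← Real.exp_add]; congr 1; ring
  rw [he, ← mul_assoc]
  refine mul_le_mul_of_nonneg_right ?_ (gWt_pos _ _).le
  rw [inv_mul_eq_div, le_div_iff₀ hd]
  nlinarith [Real.add_one_le_exp ((t - s) * x)]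

theorem gWt_le_shift {s t : ℝ} (hs : 0 ≤ s) (h : s < t) (j : Fin n) (z : Cn n) (θ : ℝ) :
    gWt t z ≤ Real.exp (s + s ^ 2 / (t - s)) * gWt s (z + rotShift j θ) := by
  have hd : 0 < t - s := sub_pos.2 h
  rw [gWt, gWt, ← Real.exp_add, Real.exp_le_exp]
  have h1 : ∀ i, s * ‖(z + rotShift j θ) i‖ ^ 2 ≤
      t * ‖z i‖ ^ 2 + if i = j then s + s ^ 2 / (t - s) else 0 := by
    intro i
    split_ifs with hi
    · subst hi
      have h2 : ‖(z + rotShift i θ) i‖ ≤ ‖z i‖ + 1 := by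
        refine (norm_add_le _ _).trans ?_
        simp [rotShift, norm_exp_ofReal_mul_I]
      have h3 : ‖(z + rotShift i θ) i‖ ^ 2 ≤ (‖z i‖ + 1) ^ 2 := by gcongr
      have h4 : t * ‖z i‖ ^ 2 + (s + s ^ 2 / (t - s)) - s * (‖z i‖ + 1) ^ 2 =
          ((t - s) * ‖z i‖ - s) ^ 2 / (t - s) := by field_simp; ring
      have h5 : 0 ≤ ((t - s) * ‖z i‖ - s) ^ 2 / (t - s) := by positivity
      nlinarith [mul_le_mul_of_nonneg_left h3 hs]
    · have : (z + rotShift j θ) i = z i := by simp [rotShift, hi]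
      rw [this, add_zero]
      gcongr
  have h2 := Finset.sum_le_sum fun i (_ : i ∈ Finset.univ) => h1 i
  rw [Finset.sum_add_distrib, ← Finset.mul_sum, ← Finset.mul_sum, Finset.sum_ite_eq'] at h2
  simp only [Finset.mem_univ, if_true] at h2
  linarith

/-- Entire functions which are square integrable against every weight `e^{-s|z|²}` with
`s > 1`. Unlike the Fock space, this class is stable under `∂/∂z_j` and multiplication by `z_j`. -/
def MemW (f : Cn n → ℂ) : Prop :=
  Differentiable ℂ f ∧ ∀ s, 1 < s → Integrable (fun z : Cn n => ‖f z‖ ^ 2 * gWt s z)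

theorem MemF.memW {f : Cn n → ℂ} (hf : MemF f) : MemW f := by
  refine ⟨hf.1, fun s hs => hf.2.mono' ?_ (.of_forall fun z => ?_)⟩
  · have := hf.1.continuous
    exact Continuous.aestronglyMeasurable (by fun_prop)
  · rw [Real.norm_of_nonneg (mul_nonneg (sq_nonneg _) (gWt_pos _ _).le), ← gWt_one]
    exact mul_le_mul_of_nonneg_left (gWt_anti hs.le z) (sq_nonneg _)

theorem MemW.coord_mul {f : Cn n → ℂ} (hf : MemW f) (j : Fin n) : MemW fun z => z j * f z := by
  refine ⟨(differentiable_apply j).mul hf.1, fun s hs => ?_⟩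
  have ht : (1 + s) / 2 < s := by linarith
  refine ((hf.2 ((1 + s) / 2) (by linarith)).const_mul (s - (1 + s) / 2)⁻¹).mono' ?_
    (.of_forall fun z => ?_)
  · have := hf.1.continuous
    exact Continuous.aestronglyMeasurable (by fun_prop)
  · rw [Real.norm_of_nonneg (mul_nonneg (sq_nonneg _) (gWt_pos _ _).le), norm_mul, mul_pow]
    nlinarith [mul_le_mul_of_nonneg_left (sq_mul_gWt_le ht j z) (sq_nonneg ‖f z‖)]

theorem MemW.pdz {f : Cn n → ℂ} (hf : MemW f) (j : Fin n) : MemW (pdz j f) := by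
  refine ⟨differentiable_pdz hf.1 j, fun s hs => ?_⟩
  have hc := hf.1.continuous
  have hc' := (differentiable_pdz hf.1 j).continuous
  have ht : (1 + s) / 2 < s := by linarith
  set t := (1 + s) / 2 with ht'
  have hK := hf.2 t (by linarith)
  have hprod : Integrable (fun q : Cn n × ℝ =>
      ‖f (q.1 + rotShift j q.2)‖ ^ 2 * gWt t (q.1 + rotShift j q.2))
      ((volume : Measure (Cn n)).prod circleProb) := by
    rw [integrable_prod_iff' (Continuous.aestronglyMeasurable (by fun_prop))]
    refine ⟨.of_forall fun θ => hK.comp_add_right (rotShift j θ), ?_⟩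
    have e : ∀ θ : ℝ, ∫ z : Cn n, ‖‖f (z + rotShift j θ)‖ ^ 2 * gWt t (z + rotShift j θ)‖ =
        ∫ z : Cn n, ‖‖f z‖ ^ 2 * gWt t z‖ := fun θ =>
      integral_add_right_eq_self (fun z : Cn n => ‖‖f z‖ ^ 2 * gWt t z‖) (rotShift j θ)
    simp only [e]
    exact integrable_const _
  have hprod' : Integrable (fun q : Cn n × ℝ => ‖f (q.1 + rotShift j q.2)‖ ^ 2 * gWt s q.1)
      ((volume : Measure (Cn n)).prod circleProb) := by
    refine (hprod.const_mul (Real.exp (t + t ^ 2 / (s - t)))).mono'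
      (Continuous.aestronglyMeasurable (by fun_prop)) (.of_forall fun q => ?_)
    rw [Real.norm_of_nonneg (mul_nonneg (sq_nonneg _) (gWt_pos _ _).le)]
    nlinarith [mul_le_mul_of_nonneg_left (gWt_le_shift (by linarith) ht j q.1 q.2)
      (sq_nonneg ‖f (q.1 + rotShift j q.2)‖)]
  refine hprod'.integral_prod_left.mono' (Continuous.aestronglyMeasurable (by fun_prop))
    (.of_forall fun z => ?_)
  rw [Real.norm_of_nonneg (mul_nonneg (sq_nonneg _) (gWt_pos _ _).le)]
  dsimp only
  rw [integral_mul_const]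
  exact mul_le_mul_of_nonneg_right (norm_sq_pdz_le hf.1 j z) (gWt_pos _ _).le

open scoped ComplexConjugate

/-- The inner product of `L²(ℂⁿ, e^{-s|z|²})`. -/
def wInner (s : ℝ) (f g : Cn n → ℂ) : ℂ := ∫ z : Cn n, f z * conj (g z) * gWt s z

theorem integrable_wInner {s : ℝ} (hs : 1 < s) {f g : Cn n → ℂ} (hf : MemW f) (hg : MemW g) :
    Integrable fun z : Cn n => f z * conj (g z) * (gWt s z : ℂ) := by
  have h1 := hf.1.continuous
  have h2 := hg.1.continuous
  refine ((hf.2 s hs).add (hg.2 s hs)).mono' ?_ (.of_forall fun z => ?_)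
  · have h3 : Continuous fun z : Cn n => (gWt s z : ℂ) := by fun_prop
    exact Continuous.aestronglyMeasurable (by fun_prop)
  · rw [norm_mul, norm_mul, RCLike.norm_conj, norm_real, Real.norm_of_nonneg (gWt_pos s z).le]
    have : ‖f z‖ * ‖g z‖ ≤ ‖f z‖ ^ 2 + ‖g z‖ ^ 2 := by
      nlinarith [sq_nonneg (‖f z‖ - ‖g z‖), sq_nonneg ‖f z‖, sq_nonneg ‖g z‖]
    calc ‖f z‖ * ‖g z‖ * gWt s z ≤ (‖f z‖ ^ 2 + ‖g z‖ ^ 2) * gWt s z :=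
          mul_le_mul_of_nonneg_right this (gWt_pos s z).le
      _ = _ := by simp [add_mul]

theorem conj_wInner (s : ℝ) (f g : Cn n → ℂ) : conj (wInner s f g) = wInner s g f := by
  rw [wInner, ← integral_conj, wInner]
  congr 1; ext z
  simp only [map_mul, conj_conj, conj_ofReal]
  ring

theorem hasLineDerivAt_of_differentiable {f : Cn n → ℂ} (hf : Differentiable ℂ f) (j : Fin n)
    (c : ℂ) (z : Cn n) :
    HasLineDerivAt ℝ f (c * pdz j f z) z (c • (Pi.single j 1 : Cn n)) := by
  have h := ((hf z).hasFDerivAt.restrictScalars ℝ).hasLineDerivAt (c • (Pi.single j 1 : Cn n))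
  simpa [pdz] using h

theorem hasLineDerivAt_gWt (s : ℝ) (j : Fin n) (c : ℂ) (z : Cn n) :
    HasLineDerivAt ℝ (fun z : Cn n => (gWt s z : ℂ))
      (-(s * (conj c * z j + c * conj (z j))) * gWt s z) z (c • (Pi.single j 1 : Cn n)) := by
  unfold HasLineDerivAt
  set v : Cn n := c • (Pi.single j 1 : Cn n) with hv
  have h1 : ∀ i, HasDerivAt (fun t : ℝ => ‖(z + t • v) i‖ ^ 2) (2 * inner ℝ (z i) (v i)) 0 := by
    intro i
    have h : HasDerivAt (fun t : ℝ => (z + t • v) i) (v i) 0 := by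
      simpa using ((hasDerivAt_id (0 : ℝ)).smul_const (v i)).const_add (z i)
    simpa using h.norm_sq
  have h2 := ((HasDerivAt.fun_sum fun i (_ : i ∈ Finset.univ) => h1 i).const_mul s).fun_neg.exp
  have h3 : ∑ i, 2 * inner ℝ (z i) (v i) = 2 * inner ℝ (z j) c := by
    rw [Finset.sum_eq_single j]
    · simp [hv]
    · intro i _ hi
      simp [hv, hi]
    · simp
  have h4 := h2.ofReal_comp
  have h5 : ((2 * inner ℝ (z j) c : ℝ) : ℂ) = conj c * z j + c * conj (z j) := by
    apply Complex.ext <;> simp [Complex.inner] <;> ring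
  have h6 : -(s * (conj c * z j + c * conj (z j))) * (gWt s z : ℂ) =
      ((Real.exp (-(s * ∑ i, ‖(z + (0 : ℝ) • v) i‖ ^ 2)) *
        -(s * ∑ i, 2 * inner ℝ (z i) (v i)) : ℝ) : ℂ) := by
    rw [← h5, h3, gWt]
    simp only [zero_smul, add_zero]
    push_cast
    ring
  rw [h6]
  exact h4

/-- On Gaussian-weighted spaces, `s z_j` is adjoint to `∂/∂z_j`. -/
theorem wInner_pdz_left {s : ℝ} (hs : 1 < s) {f g : Cn n → ℂ} (hf : MemW f) (hg : MemW g)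
    (j : Fin n) : wInner s (pdz j f) g = s * wInner s f (fun z => z j * g z) := by
  have hX := integrable_wInner hs hf (hg.pdz j)
  have hY := integrable_wInner hs (hf.coord_mul j) hg
  have hZ := integrable_wInner hs hf (hg.coord_mul j)
  have hT := integrable_wInner hs (hf.pdz j) hg
  have key : ∀ c : ℂ, conj c * wInner s f (pdz j g) - s * (conj c * wInner s (fun z => z j * f z) g
      + c * wInner s f (fun z => z j * g z)) = - (c * wInner s (pdz j f) g) := by
    intro c
    have hI := ((hX.const_mul (conj c)).sub
      (((hY.const_mul (conj c)).add (hZ.const_mul c)).const_mul (s : ℂ)))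
    have h := integral_bilinear_hasLineDerivAt_right_eq_neg_left_of_integrable
      (μ := (volume : Measure (Cn n)))
      (B := ContinuousLinearMap.mul ℝ ℂ) (f := f) (f' := fun z => c * pdz j f z)
      (g := fun z => conj (g z) * gWt s z)
      (g' := fun z => conj (c * pdz j g z) * gWt s z +
        conj (g z) * (-(s * (conj c * z j + c * conj (z j))) * gWt s z))
      (v := c • (Pi.single j 1 : Cn n)) ?_ ?_ ?_
      (fun z _ => hasLineDerivAt_of_differentiable hf.1 j c z)
      (fun z _ => ?_)
    · simp only [ContinuousLinearMap.mul_apply'] at h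
      simp only [wInner, ← integral_const_mul]
      have hYZ : Integrable fun z : Cn n => (s : ℂ) *
          (conj c * (z j * f z * conj (g z) * gWt s z) +
            c * (f z * conj (z j * g z) * gWt s z)) :=
        ((hY.const_mul (conj c)).add (hZ.const_mul c)).const_mul _
      rw [← integral_add (hY.const_mul _) (hZ.const_mul _), ← integral_const_mul,
        ← integral_sub (hX.const_mul _) hYZ]
      convert h using 1
      · congr 1; ext z; simp only [map_mul]; ring
      · congr 2; ext z; ring
    · convert hT.const_mul c using 1
      ext z; simp only [ContinuousLinearMap.mul_apply']; ring
    · convert hI using 1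
      ext z; simp only [ContinuousLinearMap.mul_apply', map_mul, Pi.sub_apply, Pi.add_apply]; ring
    · convert integrable_wInner hs hf hg using 1
      ext z; simp only [ContinuousLinearMap.mul_apply']; ring
    · have h1 : HasLineDerivAt ℝ (fun z => conj (g z)) (conj (c * pdz j g z)) z
          (c • (Pi.single j 1 : Cn n)) :=
        HasDerivAt.star (hasLineDerivAt_of_differentiable hg.1 j c z)
      have h2 := HasDerivAt.fun_mul h1 (hasLineDerivAt_gWt s j c z)
      simp only [zero_smul, add_zero] at h2
      exact h2
  have k1 := key 1
  have k2 := key I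
  simp only [map_one, conj_I] at k1 k2
  linear_combination (1 / 2) * k1 - (I / 2) * k2 +
    ((1 / 2) * (-wInner s f (pdz j g) + s * wInner s (fun z => z j * f z) g
      - s * wInner s f (fun z => z j * g z) + wInner s (pdz j f) g)) * I_sq

theorem pdz_coord_mul {f : Cn n → ℂ} (hf : Differentiable ℂ f) (j k : Fin n) (z : Cn n) :
    pdz k (fun z => z j * f z) z = (if j = k then f z else 0) + z j * pdz k f z := by
  have h := ((hasFDerivAt_apply (𝕜 := ℂ) j z).mul (hf z).hasFDerivAt).fderiv
  unfold pdz
  have e : (fun z : Cn n => z j * f z) = (fun z : Cn n => z j) * f := rfl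
  rw [e, h]
  by_cases hjk : j = k
  · subst hjk; simp; ring
  · simp [hjk]

/-- The commutation relation between `∂/∂z_k` and its adjoint, in weak form. -/
theorem sq_mul_wInner_coord_mul {s : ℝ} (hs : 1 < s) {f g : Cn n → ℂ} (hf : MemW f) (hg : MemW g)
    (j k : Fin n) :
    (s : ℂ) ^ 2 * wInner s (fun z => z j * f z) (fun z => z k * g z) =
      s * (if j = k then wInner s f g else 0) + wInner s (pdz k f) (pdz j g) := by
  have h1 := wInner_pdz_left hs (hf.coord_mul j) hg k
  have h2 := wInner_pdz_left hs hg (hf.pdz k) j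
  have h3 : wInner s (pdz k fun z => z j * f z) g =
      (if j = k then wInner s f g else 0) + wInner s (fun z => z j * pdz k f z) g := by
    have e : ∀ z, pdz k (fun z => z j * f z) z * conj (g z) * (gWt s z : ℂ) =
        (if j = k then f z * conj (g z) * (gWt s z : ℂ) else 0)
          + z j * pdz k f z * conj (g z) * gWt s z := by
      intro z; rw [pdz_coord_mul hf.1]; split_ifs <;> ring
    rw [wInner]
    simp only [e]
    rw [integral_add _ (integrable_wInner hs ((hf.pdz k).coord_mul j) hg)]
    · split_ifs <;> simp [wInner]
    · split_ifs
      · exact integrable_wInner hs hf hg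
      · simp
  have h4 := congrArg conj h2
  rw [map_mul, conj_wInner, conj_wInner, conj_ofReal] at h4
  rw [h4, ← mul_add, ← h3, h1]
  ring

theorem sum_sum_erase (F : Fin n → Finset (Fin n) → ℂ) :
    ∑ L : Finset (Fin n), ∑ j ∈ L, F j (L.erase j) =
      ∑ K : Finset (Fin n), ∑ j ∈ Kᶜ, F j K := by
  rw [Finset.sum_sigma', Finset.sum_sigma']
  refine Finset.sum_bij' (fun x _ => ⟨x.1.erase x.2, x.2⟩) (fun x _ => ⟨insert x.2 x.1, x.2⟩)
    ?_ ?_ ?_ ?_ ?_ <;> rintro ⟨L, j⟩ h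
  · simp
  · simp
  · have : j ∈ L := by simpa using h
    simp [Finset.insert_erase this]
  · have : j ∉ L := by simpa using h
    simp [Finset.erase_insert this]
  · rfl

theorem sgn_mul_self (j : Fin n) (J : Finset (Fin n)) : sgn j J * sgn j J = 1 := by
  rw [sgn, ← mul_pow]; simp

theorem conj_sgn (j : Fin n) (J : Finset (Fin n)) : conj (sgn j J) = sgn j J := by
  simp [sgn]

theorem sgn_insert {j k : Fin n} {K : Finset (Fin n)} (hk : k ∉ K) :
    sgn j (insert k K) = (if k < j then -1 else 1) * sgn j K := by
  unfold sgn
  rw [Finset.filter_insert]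
  split_ifs with h
  · rw [Finset.card_insert_of_notMem (by simp [hk]), pow_succ]; ring
  · simp

theorem sgn_insert_mul_sgn_insert {j k : Fin n} (hjk : j ≠ k) {K : Finset (Fin n)}
    (hj : j ∉ K) (hk : k ∉ K) :
    sgn j (insert k K) * sgn k (insert j K) = -(sgn j K * sgn k K) := by
  rw [sgn_insert hk, sgn_insert hj]
  rcases lt_or_gt_of_ne hjk with h | h
  · simp [h, h.not_gt]
  · simp [h, h.not_gt]

theorem sum_sgn_erase_mul (P : Fin n → Finset (Fin n) → Fin n → Finset (Fin n) → ℂ) :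
    (∑ L : Finset (Fin n), ∑ j ∈ L, ∑ k ∈ L,
        sgn j (L.erase j) * sgn k (L.erase k) * P j (L.erase j) k (L.erase k)) +
      ∑ K : Finset (Fin n), ∑ j ∈ Kᶜ, ∑ k ∈ Kᶜ,
        sgn j K * sgn k K * P k (insert j K) j (insert k K) =
    ∑ J : Finset (Fin n), ∑ j, P j J j J := by
  have h1 : ∑ L : Finset (Fin n), ∑ j ∈ L, ∑ k ∈ L,
        sgn j (L.erase j) * sgn k (L.erase k) * P j (L.erase j) k (L.erase k) =
      (∑ J : Finset (Fin n), ∑ j ∈ Jᶜ, P j J j J) +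
      ∑ J : Finset (Fin n), ∑ j ∈ Jᶜ, ∑ k ∈ J,
        sgn j J * sgn k (insert j (J.erase k)) * P j J k (insert j (J.erase k)) := by
    have e := sum_sum_erase fun (j : Fin n) J => ∑ k ∈ insert j J,
        sgn j J * sgn k ((insert j J).erase k) * P j J k ((insert j J).erase k)
    rw [← Finset.sum_add_distrib]
    trans ∑ K : Finset (Fin n), ∑ j ∈ Kᶜ, ∑ k ∈ insert j K,
        sgn j K * sgn k ((insert j K).erase k) * P j K k ((insert j K).erase k)
    · rw [← e]
      refine Finset.sum_congr rfl fun L _ => Finset.sum_congr rfl fun j hj => ?_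
      simp only [Finset.insert_erase hj]
    · refine Finset.sum_congr rfl fun J _ => ?_
      rw [← Finset.sum_add_distrib]
      refine Finset.sum_congr rfl fun j hj => ?_
      have hj' : j ∉ J := by simpa using hj
      rw [Finset.sum_insert hj', Finset.erase_insert hj', sgn_mul_self, one_mul]
      congr 1
      refine Finset.sum_congr rfl fun k hk => ?_
      have hjk : j ≠ k := fun h => hj' (h ▸ hk)
      rw [Finset.erase_insert_of_ne hjk]
  have h2 : ∑ J : Finset (Fin n), ∑ j ∈ Jᶜ, ∑ k ∈ J,
        sgn j J * sgn k (insert j (J.erase k)) * P j J k (insert j (J.erase k)) =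
      -∑ K : Finset (Fin n), ∑ k ∈ Kᶜ, ∑ j ∈ Kᶜ.erase k,
        sgn k K * sgn j K * P j (insert k K) k (insert j K) := by
    have e := sum_sum_erase fun (k : Fin n) K => ∑ j ∈ (insert k K)ᶜ,
        sgn j (insert k K) * sgn k (insert j K) * P j (insert k K) k (insert j K)
    trans ∑ K : Finset (Fin n), ∑ k ∈ Kᶜ, ∑ j ∈ (insert k K)ᶜ,
        sgn j (insert k K) * sgn k (insert j K) * P j (insert k K) k (insert j K)
    · rw [← e]
      refine Finset.sum_congr rfl fun J _ => ?_
      rw [Finset.sum_comm]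
      refine Finset.sum_congr rfl fun k hk => ?_
      simp only [Finset.insert_erase hk]
    · simp only [← Finset.sum_neg_distrib]
      refine Finset.sum_congr rfl fun K _ => Finset.sum_congr rfl fun k hk => ?_
      rw [Finset.compl_insert]
      refine Finset.sum_congr rfl fun j hj => ?_
      have hj' : j ≠ k ∧ j ∉ K := by simpa using hj
      rw [sgn_insert_mul_sgn_insert hj'.1 hj'.2 (by simpa using hk)]
      ring
  have h3 : ∑ K : Finset (Fin n), ∑ j ∈ Kᶜ, ∑ k ∈ Kᶜ,
        sgn j K * sgn k K * P k (insert j K) j (insert k K) =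
      (∑ J : Finset (Fin n), ∑ j ∈ J, P j J j J) +
      ∑ K : Finset (Fin n), ∑ k ∈ Kᶜ, ∑ j ∈ Kᶜ.erase k,
        sgn k K * sgn j K * P j (insert k K) k (insert j K) := by
    have e := sum_sum_erase fun (j : Fin n) K => P j (insert j K) j (insert j K)
    have e' : ∑ J : Finset (Fin n), ∑ j ∈ J, P j J j J =
        ∑ K : Finset (Fin n), ∑ j ∈ Kᶜ, P j (insert j K) j (insert j K) := by
      rw [← e]
      refine Finset.sum_congr rfl fun L _ => Finset.sum_congr rfl fun j hj => ?_
      simp only [Finset.insert_erase hj]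
    rw [e', ← Finset.sum_add_distrib]
    refine Finset.sum_congr rfl fun K _ => ?_
    rw [← Finset.sum_add_distrib]
    refine Finset.sum_congr rfl fun j hj => ?_
    rw [← Finset.add_sum_erase _ _ hj, sgn_mul_self, one_mul]
  rw [h1, h2, h3]
  have h4 : ∑ J : Finset (Fin n), ∑ j, P j J j J =
      (∑ J : Finset (Fin n), ∑ j ∈ J, P j J j J) + ∑ J : Finset (Fin n), ∑ j ∈ Jᶜ, P j J j J := by
    rw [← Finset.sum_add_distrib]
    exact Finset.sum_congr rfl fun J _ => (Finset.sum_add_sum_compl J _).symm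
  rw [h4]
  ring

theorem wInner_sum_sum {ι : Type*} {s : ℝ} (hs : 1 < s) (t : Finset ι) (c : ι → ℂ)
    (hc : ∀ i, conj (c i) = c i) (f : ι → Cn n → ℂ) (hf : ∀ i, MemW (f i)) :
    wInner s (fun z => ∑ i ∈ t, c i * f i z) (fun z => ∑ i ∈ t, c i * f i z) =
      ∑ i ∈ t, ∑ k ∈ t, c i * c k * wInner s (f i) (f k) := by
  have hI : ∀ i k, Integrable fun z : Cn n =>
      c i * c k * (f i z * conj (f k z) * (gWt s z : ℂ)) :=
    fun i k => (integrable_wInner hs (hf i) (hf k)).const_mul _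
  simp only [wInner, ← integral_const_mul]
  simp_rw [← integral_finsetSum t fun k _ => hI _ k]
  rw [← integral_finsetSum t fun i _ => integrable_finsetSum t fun k _ => hI i k]
  congr 1; ext z
  rw [map_sum, Finset.sum_mul_sum, Finset.sum_mul]
  refine Finset.sum_congr rfl fun i _ => ?_
  rw [Finset.sum_mul]
  refine Finset.sum_congr rfl fun k _ => ?_
  rw [map_mul, hc]
  ring

/-- The Bochner–Kodaira identity for `(p,0)`-forms and the weight `e^{-s|z|²}`. -/
theorem wInner_dOp_add_wInner_dStarOp {s : ℝ} (hs : 1 < s) {p : ℕ} {u : FormC n}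
    (hdeg : IsDeg p u) (hu : ∀ J, MemW (u J)) :
    ∑ L, wInner s (dOp u L) (dOp u L) + (s : ℂ) ^ 2 * ∑ K, wInner s (dStarOp u K) (dStarOp u K) =
      s * p * ∑ J, wInner s (u J) (u J) + ∑ J, ∑ j, wInner s (pdz j (u J)) (pdz j (u J)) := by
  have hA : ∀ L, wInner s (dOp u L) (dOp u L) = ∑ j ∈ L, ∑ k ∈ L,
      sgn j (L.erase j) * sgn k (L.erase k) *
        wInner s (pdz j (u (L.erase j))) (pdz k (u (L.erase k))) := fun L =>
    wInner_sum_sum hs L _ (fun j => conj_sgn j _) _ fun j => (hu _).pdz j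
  have hB : ∀ K, (s : ℂ) ^ 2 * wInner s (dStarOp u K) (dStarOp u K) =
      (∑ j ∈ Kᶜ, s * wInner s (u (insert j K)) (u (insert j K))) +
      ∑ j ∈ Kᶜ, ∑ k ∈ Kᶜ, sgn j K * sgn k K *
        wInner s (pdz k (u (insert j K))) (pdz j (u (insert k K))) := by
    intro K
    have e := wInner_sum_sum hs Kᶜ (fun j => sgn j K) (fun j => conj_sgn j _)
      (fun j z => z j * u (insert j K) z) fun j => (hu _).coord_mul j
    have e' : wInner s (dStarOp u K) (dStarOp u K) = _ := e
    rw [e', Finset.mul_sum, ← Finset.sum_add_distrib]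
    refine Finset.sum_congr rfl fun j hj => ?_
    have hd : s * wInner s (u (insert j K)) (u (insert j K)) = ∑ k ∈ Kᶜ, sgn j K * sgn k K *
        (s * (if j = k then wInner s (u (insert j K)) (u (insert k K)) else 0)) := by
      rw [Finset.sum_eq_single_of_mem j hj]
      · rw [sgn_mul_self]; simp
      · intro k _ hk
        simp [hk.symm]
    rw [hd, Finset.mul_sum, ← Finset.sum_add_distrib]
    refine Finset.sum_congr rfl fun k _ => ?_
    linear_combination (sgn j K * sgn k K) * sq_mul_wInner_coord_mul hs (hu (insert j K))
      (hu (insert k K)) j k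
  have hU : ∑ K : Finset (Fin n), ∑ j ∈ Kᶜ, s * wInner s (u (insert j K)) (u (insert j K)) =
      s * p * ∑ J, wInner s (u J) (u J) := by
    rw [← sum_sum_erase fun j K => s * wInner s (u (insert j K)) (u (insert j K)), Finset.mul_sum]
    refine Finset.sum_congr rfl fun L _ => ?_
    rw [Finset.sum_congr rfl fun j hj => by rw [Finset.insert_erase hj], Finset.sum_const,
      nsmul_eq_mul]
    by_cases hL : L.card = p
    · rw [hL]; ring
    · simp [hdeg L hL, wInner]
  have hP := sum_sgn_erase_mul fun j J k J' => wInner s (pdz j (u J)) (pdz k (u J'))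
  rw [Finset.mul_sum, Finset.sum_congr rfl fun L _ => hA L,
    Finset.sum_congr rfl fun K _ => hB K, Finset.sum_add_distrib, hU, ← hP]
  ring

/-- The squared norm of `L²(ℂⁿ, e^{-s|z|²})`. -/
def wNormSq (s : ℝ) (f : Cn n → ℂ) : ℝ := ∫ z : Cn n, ‖f z‖ ^ 2 * gWt s z

theorem wNormSq_nonneg (s : ℝ) (f : Cn n → ℂ) : 0 ≤ wNormSq s f :=
  integral_nonneg fun z => mul_nonneg (sq_nonneg _) (gWt_pos s z).le

theorem wInner_self (s : ℝ) (f : Cn n → ℂ) : wInner s f f = wNormSq s f := by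
  rw [wInner, wNormSq, ← integral_complex_ofReal]
  congr 1; ext z
  rw [mul_conj']
  push_cast
  rfl

theorem wNormSq_basic_estimate {s : ℝ} (hs : 1 < s) {p : ℕ} {u : FormC n}
    (hdeg : IsDeg p u) (hu : ∀ J, MemW (u J)) :
    s * p * ∑ J, wNormSq s (u J) ≤
      ∑ L, wNormSq s (dOp u L) + s ^ 2 * ∑ K, wNormSq s (dStarOp u K) := by
  have h := wInner_dOp_add_wInner_dStarOp hs hdeg hu
  simp only [wInner_self] at h
  have h' : ∑ L, wNormSq s (dOp u L) + s ^ 2 * ∑ K, wNormSq s (dStarOp u K) =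
      s * p * ∑ J, wNormSq s (u J) + ∑ J, ∑ j, wNormSq s (pdz j (u J)) := by exact_mod_cast h
  rw [h', le_add_iff_nonneg_right]
  exact Finset.sum_nonneg fun J _ => Finset.sum_nonneg fun j _ => wNormSq_nonneg _ _

theorem tendsto_wNormSq {f : Cn n → ℂ} (hf : MemF f) :
    Tendsto (fun s => wNormSq s f) (𝓝[>] 1) (𝓝 (fNormSq f)) := by
  have hc := hf.1.continuous
  refine tendsto_integral_filter_of_dominated_convergence _
    (.of_forall fun s => Continuous.aestronglyMeasurable (by fun_prop)) ?_ hf.2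
    (.of_forall fun z => ?_)
  · filter_upwards [self_mem_nhdsWithin] with s hs
    refine .of_forall fun z => ?_
    rw [Real.norm_of_nonneg (mul_nonneg (sq_nonneg _) (gWt_pos s z).le), ← gWt_one]
    exact mul_le_mul_of_nonneg_left (gWt_anti (le_of_lt hs) z) (sq_nonneg _)
  · have h : Continuous fun s : ℝ => ‖f z‖ ^ 2 * gWt s z := by unfold gWt; fun_prop
    rw [← gWt_one]
    exact (h.tendsto 1).mono_left nhdsWithin_le_nhds

/-- The basic estimate: for a `(p,0)`-form `u ∈ dom ∂ ∩ dom ∂*` with Fock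
coefficients, `1 ≤ p ≤ n−1`: `‖u‖² ≤ (1/p)(‖∂u‖² + ‖∂*u‖²)`. -/
theorem stmt10 {n p : ℕ} (hp : 1 ≤ p) (hpn : p ≤ n - 1)
    (u : FormC n) (hdeg : IsDeg p u) (h1 : domD u) (h2 : domDs u) :
    formNormSq u ≤ (1 / p) * (formNormSq (dOp u) + formNormSq (dStarOp u)) := by
  have hp0 : (0 : ℝ) < p := by exact_mod_cast hp
  have lim : ∀ {v : FormC n}, MemA2 v →
      Tendsto (fun s => ∑ J, wNormSq s (v J)) (𝓝[>] 1) (𝓝 (formNormSq v)) := fun hv =>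
    tendsto_finsetSum _ fun J _ => tendsto_wNormSq (hv J)
  have hs : Tendsto (fun s : ℝ => s) (𝓝[>] 1) (𝓝 1) := nhdsWithin_le_nhds
  have key : 1 * (p : ℝ) * formNormSq u ≤
      formNormSq (dOp u) + 1 ^ 2 * formNormSq (dStarOp u) :=
    le_of_tendsto_of_tendsto ((hs.mul_const (p : ℝ)).mul (lim h1.1))
      ((lim h1.2).add ((hs.pow 2).mul (lim h2.2)))
      (eventually_mem_nhdsWithin.mono fun s hs' =>
        wNormSq_basic_estimate hs' hdeg fun J => (h1.1 J).memW)
  rw [one_div, inv_mul_eq_div, le_div_iff₀ hp0]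
  linarith
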